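/- There exists a constant c > 0 such that for every n ≥ 1 and every injective map p : Fin n → ℤ × ℤ, there exists a map q : Fin n → ℚ × ℚ with the following properties: for each i, |(q i).1 − (p i).1| ≤ 1/2 and |(q i).2 − (p i).2| ≤ 1/2 (each point is displaced within the axis-aligned unit square centered at the original point); each (q i).1 is a rational number with denominator dividing ⌈c·n⌉ and each (q i).2 is a rational number with denominator dividing ⌈c·n²⌉ (so the points lie on a grid refining each unit square into a ⌈c·n⌉ × ⌈c·n²⌉ subgrid); and no three of the points q i, q j, q k (for distinct i, j, k) are collinear in ℝ². -/

import Mathlib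

/-- Regard a rational point as a point of the real plane. -/
def ratToPlane (q : ℚ × ℚ) : ℝ × ℝ := ((q.1 : ℝ), (q.2 : ℝ))

/-- Twice the signed area of the triangle with vertices `a`, `b`, `c`. -/
def signedArea {K : Type*} [Field K] (a b c : K × K) : K :=
  (b.1 - a.1) * (c.2 - a.2) - (c.1 - a.1) * (b.2 - a.2)

lemma signedArea_rotate {K : Type*} [Field K] (a b c : K × K) :
    signedArea a b c = signedArea b c a := by
  simp only [signedArea]
  ring

lemma eq_of_signedArea_eq_zero {K : Type*} [Field K] {a b c : K × K} (hab : a.1 ≠ b.1)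
    (h : signedArea a b c = 0) :
    c.2 = a.2 + (b.2 - a.2) / (b.1 - a.1) * (c.1 - a.1) := by
  have hne : b.1 - a.1 ≠ 0 := sub_ne_zero.mpr hab.symm
  simp only [signedArea] at h
  field_simp
  linear_combination h

lemma signedArea_eq_zero_of_collinear {a b c : ℚ × ℚ}
    (h : Collinear ℝ {ratToPlane a, ratToPlane b, ratToPlane c}) : signedArea a b c = 0 := by
  obtain ⟨v, hv⟩ := (collinear_iff_of_mem (p₀ := ratToPlane a) (by simp)).1 h
  obtain ⟨r, hr⟩ := hv (ratToPlane b) (by simp)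
  obtain ⟨t, ht⟩ := hv (ratToPlane c) (by simp)
  simp only [ratToPlane, vadd_eq_add, Prod.ext_iff, Prod.fst_add, Prod.snd_add, Prod.smul_fst,
    Prod.smul_snd, smul_eq_mul] at hr ht
  have hreal : ((b.1 : ℝ) - a.1) * (c.2 - a.2) - (c.1 - a.1) * (b.2 - a.2) = 0 := by
    rw [hr.1, hr.2, ht.1, ht.2]
    ring
  simp only [signedArea]
  exact_mod_cast hreal

/-- Greedy choice of points with pairwise distinct abscissas and no three on a line, the
coordinates of each point coming from prescribed sufficiently large finite sets. -/
lemma exists_general_position {ι K : Type*} [Field K] (X Y : ι → Finset K) (s : Finset ι)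
    (hX : ∀ i, s.card < (X i).card) (hY : ∀ i, s.card ^ 2 < (Y i).card) :
    ∃ q : ι → K × K, (∀ i ∈ s, (q i).1 ∈ X i ∧ (q i).2 ∈ Y i) ∧
      (∀ i ∈ s, ∀ j ∈ s, i ≠ j → (q i).1 ≠ (q j).1) ∧
      ∀ i ∈ s, ∀ j ∈ s, ∀ k ∈ s, i ≠ j → i ≠ k → j ≠ k → signedArea (q i) (q j) (q k) ≠ 0 := by
  classical
  induction s using Finset.induction_on with
  | empty => exact ⟨fun _ => 0, by simp⟩
  | insert a s ha ih =>
    have hle : s.card ≤ (insert a s).card := Finset.card_le_card (Finset.subset_insert a s)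
    obtain ⟨q, hmem, hfst, harea⟩ := ih (fun i => hle.trans_lt (hX i))
      (fun i => (Nat.pow_le_pow_left hle 2).trans_lt (hY i))
    obtain ⟨x, hx, hxs⟩ := Finset.exists_mem_notMem_of_card_lt_card
      ((Finset.card_image_le (s := s) (f := fun i => (q i).1)).trans_lt (hle.trans_lt (hX a)))
    let lineAt : ι × ι → K := fun ij =>
      (q ij.1).2 + ((q ij.2).2 - (q ij.1).2) / ((q ij.2).1 - (q ij.1).1) * (x - (q ij.1).1)
    have hcard : ((s ×ˢ s).image lineAt).card < (Y a).card := by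
      refine Finset.card_image_le.trans_lt (lt_of_le_of_lt ?_ (hY a))
      rw [Finset.card_product, ← sq]
      exact Nat.pow_le_pow_left hle 2
    obtain ⟨y, hy, hys⟩ := Finset.exists_mem_notMem_of_card_lt_card hcard
    have hxne : ∀ i ∈ s, (q i).1 ≠ x := fun i hi h => hxs (Finset.mem_image.2 ⟨i, hi, h⟩)
    have hnew : ∀ i ∈ s, ∀ j ∈ s, i ≠ j → signedArea (q i) (q j) (x, y) ≠ 0 :=
      fun i hi j hj hij h => hys (Finset.mem_image.2 ⟨(i, j), Finset.mk_mem_product hi hj,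
        (eq_of_signedArea_eq_zero (hfst i hi j hj hij) h).symm⟩)
    have hold : ∀ i ∈ s, Function.update q a (x, y) i = q i := fun i hi =>
      Function.update_of_ne (ne_of_mem_of_not_mem hi ha) _ _
    have hself : Function.update q a (x, y) a = (x, y) := Function.update_self a _ q
    refine ⟨Function.update q a (x, y), ?_, ?_, ?_⟩
    · intro i hi
      rcases Finset.mem_insert.1 hi with rfl | hi
      · rw [hself]
        exact ⟨hx, hy⟩
      · rw [hold i hi]
        exact hmem i hi
    · intro i hi j hj hij
      rcases Finset.mem_insert.1 hi with rfl | his <;> rcases Finset.mem_insert.1 hj with rfl | hjs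
      · exact absurd rfl hij
      · rw [hself, hold j hjs]
        exact (hxne j hjs).symm
      · rw [hself, hold i his]
        exact hxne i his
      · rw [hold i his, hold j hjs]
        exact hfst i his j hjs hij
    · intro i hi j hj k hk hij hik hjk
      by_cases hia : i = a
      · subst hia
        have hjs := Finset.mem_of_mem_insert_of_ne hj hij.symm
        have hks := Finset.mem_of_mem_insert_of_ne hk hik.symm
        rw [hself, hold j hjs, hold k hks, signedArea_rotate]
        exact hnew j hjs k hks hjk
      have his := Finset.mem_of_mem_insert_of_ne hi hia
      by_cases hja : j = a
      · subst hja
        have hks := Finset.mem_of_mem_insert_of_ne hk hjk.symm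
        rw [hself, hold i his, hold k hks, ← signedArea_rotate]
        exact hnew k hks i his hik.symm
      have hjs := Finset.mem_of_mem_insert_of_ne hj hja
      by_cases hka : k = a
      · subst hka
        rw [hself, hold i his, hold j hjs]
        exact hnew i his j hjs hij
      have hks := Finset.mem_of_mem_insert_of_ne hk hka
      rw [hold i his, hold j hjs, hold k hks]
      exact harea i his j hjs k hks hij hik hjk

lemma exists_finset_near_int (z : ℤ) {m : ℕ} (hm : 0 < m) :
    ∃ S : Finset ℚ, m < S.card ∧
      ∀ x ∈ S, |x - (z : ℚ)| ≤ 1 / 2 ∧ (x.den : ℤ) ∣ 2 * (m : ℤ) := by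
  have hm' : (0 : ℚ) < m := by exact_mod_cast hm
  have hinj : Function.Injective fun b : ℕ => (z : ℚ) + b / (2 * m) := by
    intro b c h
    have h' := add_left_cancel h
    rw [div_left_inj' (by positivity)] at h'
    exact_mod_cast h'
  refine ⟨(Finset.range (m + 1)).image fun b : ℕ => (z : ℚ) + b / (2 * m), ?_, ?_⟩
  · rw [Finset.card_image_of_injective _ hinj, Finset.card_range]
    exact Nat.lt_succ_self m
  · intro x hx
    obtain ⟨b, hb, rfl⟩ := Finset.mem_image.1 hx
    have hb' : (b : ℚ) ≤ m := by exact_mod_cast Nat.lt_succ_iff.1 (Finset.mem_range.1 hb)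
    constructor
    · rw [add_sub_cancel_left, abs_of_nonneg (by positivity), div_le_div_iff₀ (by positivity)
        (by norm_num)]
      linarith
    · have hfrac : (z : ℚ) + b / (2 * m) = Rat.divInt (z * (2 * m) + b) (2 * m) := by
        rw [Rat.divInt_eq_div]
        push_cast
        field_simp
      rw [hfrac]
      exact Rat.den_dvd _ _

/-- Any `n` integer grid points can be perturbed into general position, each point
moving within the axis-aligned unit square centered at it, using only points of a
grid refining each unit square into an `O(n) × O(n²)` subgrid. -/
theorem perturb_grid_points_to_general_position :
    ∃ c : ℝ, 0 < c ∧ ∀ n : ℕ, 1 ≤ n → ∀ p : Fin n → ℤ × ℤ, Function.Injective p →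
      ∃ q : Fin n → ℚ × ℚ,
        (∀ i, |(q i).1 - ((p i).1 : ℚ)| ≤ 1 / 2 ∧ |(q i).2 - ((p i).2 : ℚ)| ≤ 1 / 2) ∧
        (∀ i, ((q i).1.den : ℤ) ∣ ⌈c * (n : ℝ)⌉ ∧ ((q i).2.den : ℤ) ∣ ⌈c * (n : ℝ) ^ 2⌉) ∧
        (∀ i j k : Fin n, i ≠ j → i ≠ k → j ≠ k →
          ¬ Collinear ℝ {ratToPlane (q i), ratToPlane (q j), ratToPlane (q k)}) := by
  refine ⟨2, two_pos, fun n hn p _ => ?_⟩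
  choose X hXcard hX using fun i => exists_finset_near_int (p i).1 (m := n) hn
  choose Y hYcard hY using fun i => exists_finset_near_int (p i).2 (m := n ^ 2) (by positivity)
  obtain ⟨q, hmem, -, harea⟩ := exists_general_position X Y Finset.univ
    (by simpa using hXcard) (by simpa using hYcard)
  have hceil : ∀ m : ℕ, ⌈(2 : ℝ) * (m : ℝ)⌉ = 2 * (m : ℤ) := fun m => by
    rw [Int.ceil_eq_iff]
    push_cast
    constructor <;> linarith
  refine ⟨q, fun i => ?_, fun i => ?_, fun i j k hij hik hjk h => ?_⟩
  · obtain ⟨h₁, h₂⟩ := hmem i (Finset.mem_univ i)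
    exact ⟨(hX i _ h₁).1, (hY i _ h₂).1⟩
  · obtain ⟨h₁, h₂⟩ := hmem i (Finset.mem_univ i)
    rw [← Nat.cast_pow, hceil, hceil]
    exact ⟨(hX i _ h₁).2, (hY i _ h₂).2⟩
  · exact harea i (Finset.mem_univ i) j (Finset.mem_univ j) k (Finset.mem_univ k) hij hik hjk
      (signedArea_eq_zero_of_collinear h)
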